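/- For any real t and any M > 2, the coefficients a_n(t) := Σ_{k≥0} α_{n+2k}(t)/(M−1)^k satisfy Σ_{n≥0} |a_n(t)|² = 1 + O(M^{-1}), i.e., |Σ_{n≥0}|a_n(t)|² − 1| ≤ C/M for a universal constant C, uniformly in t. -/

import Mathlib

open scoped Real

/-- Chebyshev transform coefficient of `ξ ↦ e^{-itξ}`. -/
noncomputable def chebAlpha (k : ℕ) (t : ℝ) : ℂ :=
  (2 / (π : ℂ)) * ∫ ξ in (-1:ℝ)..1,
    (Real.sqrt (1 - ξ ^ 2) : ℂ) * Complex.exp (-Complex.I * t * ξ) *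
      (Polynomial.Chebyshev.U ℂ (k : ℤ)).eval (ξ : ℂ)

/-- `a_n(t) = Σ_{k≥0} α_{n+2k}(t)/(M−1)^k`. -/
noncomputable def aCoeff (M : ℕ) (n : ℕ) (t : ℝ) : ℂ :=
  ∑' k : ℕ, chebAlpha (n + 2 * k) t / ((M : ℂ) - 1) ^ k

open MeasureTheory intervalIntegral in
/-- The substitution `ξ = cos θ` in the Chebyshev coefficients of the exponential. -/
lemma chebAlpha_eq_integral_sin (k : ℕ) (t : ℝ) :
    chebAlpha k t = (2 / (π : ℂ)) * ∫ θ in (0:ℝ)..π,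
      (Real.sin ((k + 1) * θ) : ℂ) * ((Real.sin θ : ℂ) *
        Complex.exp (-Complex.I * t * Real.cos θ)) := by
  unfold chebAlpha
  congr 1
  set g : ℝ → ℂ := fun ξ => (Real.sqrt (1 - ξ ^ 2) : ℂ) * Complex.exp (-Complex.I * t * ξ) *
      (Polynomial.Chebyshev.U ℂ (k : ℤ)).eval (ξ : ℂ) with hg
  have hgc : Continuous g := by
    have : Continuous fun ξ : ℝ => (Polynomial.Chebyshev.U ℂ (k : ℤ)).eval (ξ : ℂ) :=
      (Polynomial.continuous _).comp Complex.continuous_ofReal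
    fun_prop
  have h := integral_deriv_smul_comp (a := 0) (b := π) (f := Real.cos)
    (f' := fun x => -Real.sin x) (g := g) (fun x _ => Real.hasDerivAt_cos x)
    (by fun_prop) hgc
  rw [Real.cos_zero, Real.cos_pi, integral_symm (-1) 1] at h
  rw [← neg_inj, ← h, ← intervalIntegral.integral_neg]
  refine integral_congr fun θ hθ => ?_
  rw [Set.uIcc_of_le Real.pi_pos.le] at hθ
  have hs : 0 ≤ Real.sin θ := Real.sin_nonneg_of_mem_Icc hθ
  have hU := Polynomial.Chebyshev.U_complex_cos (θ : ℂ) (k : ℤ)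
  have hsq : Real.sqrt (1 - Real.cos θ ^ 2) = Real.sin θ := by
    rw [← Real.sin_sq, Real.sqrt_sq hs]
  simp only [hg, Function.comp_apply, hsq, Complex.real_smul]
  push_cast at hU ⊢
  rw [← hU]
  ring

/-- The odd `2π`-periodic function whose Fourier coefficients encode `chebAlpha`. -/
noncomputable def sinMulExpCos (t θ : ℝ) : ℂ :=
  (Real.sin θ : ℂ) * Complex.exp (-Complex.I * t * Real.cos θ)

lemma continuous_sinMulExpCos (t : ℝ) : Continuous (sinMulExpCos t) := by
  unfold sinMulExpCos
  fun_prop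

lemma norm_sinMulExpCos_sq (t θ : ℝ) : ‖sinMulExpCos t θ‖ ^ 2 = Real.sin θ ^ 2 := by
  have : -Complex.I * t * Real.cos θ = ((-(t * Real.cos θ) : ℝ) : ℂ) * Complex.I := by
    push_cast; ring
  rw [sinMulExpCos, this, norm_mul, Complex.norm_exp_ofReal_mul_I, mul_one, Complex.norm_real,
    Real.norm_eq_abs, sq_abs]

lemma neg_pi_lt_pi : -π < π := by linarith [Real.pi_pos]

open MeasureTheory intervalIntegral in
lemma fourierCoeffOn_sinMulExpCos (t : ℝ) (m : ℤ) :
    fourierCoeffOn neg_pi_lt_pi (sinMulExpCos t) m =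
      (-Complex.I / π) * ∫ θ in (0:ℝ)..π, (Real.sin (m * θ) : ℂ) * sinMulExpCos t θ := by
  have hfourier (x : ℝ) : fourier (-m) (x : AddCircle (π - -π)) =
      Complex.exp (-(m * x * Complex.I)) := by
    rw [fourier_coe_apply]
    congr 1
    have : (π : ℂ) ≠ 0 := by exact_mod_cast Real.pi_ne_zero
    push_cast
    field_simp
    ring
  rw [fourierCoeffOn_eq_integral]
  simp only [hfourier, smul_eq_mul]
  have hc := continuous_sinMulExpCos t
  have hint (a b : ℝ) : IntervalIntegrable
      (fun x : ℝ => Complex.exp (-(m * x * Complex.I)) * sinMulExpCos t x) volume a b :=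
    Continuous.intervalIntegrable (by fun_prop) _ _
  have hint' : IntervalIntegrable
      (fun x : ℝ => Complex.exp (-(m * (-x : ℝ) * Complex.I)) * sinMulExpCos t (-x))
      volume 0 π :=
    Continuous.intervalIntegrable (by fun_prop) _ _
  rw [← integral_add_adjacent_intervals (hint (-π) 0) (hint 0 π)]
  have hneg := integral_comp_neg (a := 0) (b := π)
    (fun x : ℝ => Complex.exp (-(m * x * Complex.I)) * sinMulExpCos t x)
  rw [neg_zero] at hneg
  rw [← hneg, ← integral_add hint' (hint 0 π)]
  have hpt (x : ℝ) : Complex.exp (-(m * (-x : ℝ) * Complex.I)) * sinMulExpCos t (-x) +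
      Complex.exp (-(m * x * Complex.I)) * sinMulExpCos t x =
      (-2 * Complex.I) * ((Real.sin (m * x) : ℂ) * sinMulExpCos t x) := by
    have hodd : sinMulExpCos t (-x) = -sinMulExpCos t x := by simp [sinMulExpCos]
    rw [hodd]
    push_cast
    rw [Complex.sin]
    simp only [neg_mul, mul_neg, neg_neg]
    linear_combination ((Complex.exp (-(m * x * Complex.I)) - Complex.exp (m * x * Complex.I)) *
      sinMulExpCos t x) * Complex.I_sq
  simp only [hpt]
  rw [intervalIntegral.integral_const_mul, Complex.real_smul]
  push_cast
  have : (π : ℂ) ≠ 0 := by exact_mod_cast Real.pi_ne_zero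
  field_simp
  ring

open MeasureTheory in
/-- Parseval's identity for the Chebyshev coefficients of `ξ ↦ e^{-itξ}`. -/
theorem hasSum_sq_norm_chebAlpha (t : ℝ) : HasSum (fun n => ‖chebAlpha n t‖ ^ 2) 1 := by
  have hL2 : MemLp (sinMulExpCos t) 2 (volume.restrict (Set.Ioc (-π) π)) := by
    refine MemLp.of_bound (continuous_sinMulExpCos t).aestronglyMeasurable 1 (.of_forall fun x => ?_)
    rw [← sq_le_one_iff₀ (norm_nonneg _), norm_sinMulExpCos_sq]
    exact Real.sin_sq_le_one x
  have hP := hasSum_sq_fourierCoeffOn neg_pi_lt_pi hL2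
  set c : ℤ → ℝ := fun m => ‖fourierCoeffOn neg_pi_lt_pi (sinMulExpCos t) m‖ ^ 2 with hc
  have hval : (π - -π)⁻¹ • ∫ x in (-π)..π, ‖sinMulExpCos t x‖ ^ 2 = 1 / 2 := by
    simp only [norm_sinMulExpCos_sq, integral_sin_sq]
    have := Real.pi_pos
    simp
    field_simp
    ring
  rw [hval] at hP
  have hzero : c 0 = 0 := by simp [hc, fourierCoeffOn_sinMulExpCos]
  have hneg (m : ℤ) : c (-m) = c m := by
    simp [hc, fourierCoeffOn_sinMulExpCos]
  have hsucc (n : ℕ) : c ((n : ℤ) + 1) = ‖chebAlpha n t‖ ^ 2 / 4 := by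
    have : fourierCoeffOn neg_pi_lt_pi (sinMulExpCos t) ((n : ℤ) + 1) =
        (-Complex.I / 2) * chebAlpha n t := by
      rw [fourierCoeffOn_sinMulExpCos, chebAlpha_eq_integral_sin]
      simp only [sinMulExpCos]
      push_cast
      ring
    simp only [hc, this, norm_mul, norm_div, norm_neg, Complex.norm_I, mul_pow]
    norm_num
    ring
  have hN := hP.nat_add_neg
  rw [hzero, add_zero] at hN
  have hN' := (hasSum_nat_add_iff' 1).mpr hN
  simp only [hneg, Finset.range_one, Finset.sum_singleton, Nat.cast_zero, hzero,
    Nat.cast_add, Nat.cast_one, hsucc] at hN'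
  have hterm : (fun n => 2 * (‖chebAlpha n t‖ ^ 2 / 4 + ‖chebAlpha n t‖ ^ 2 / 4)) =
      fun n => ‖chebAlpha n t‖ ^ 2 := by
    ext n; ring
  have hmul := hN'.mul_left 2
  rw [hterm] at hmul
  norm_num at hmul
  exact hmul

section GeometricShift

variable {α : ℕ → ℂ} {r : ℝ}

lemma summable_shift_mul_pow (hα : ∀ n, ‖α n‖ ≤ 1) (h0 : 0 ≤ r) (h1 : r ≤ 1 / 2) (n : ℕ) :
    Summable fun k => α (n + 2 * k) * (r : ℂ) ^ k := by
  refine Summable.of_norm_bounded (g := fun k => r ^ k)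
    (summable_geometric_of_lt_one h0 (by linarith)) fun k => ?_
  rw [norm_mul, norm_pow, Complex.norm_real, Real.norm_of_nonneg h0]
  exact mul_le_of_le_one_left (by positivity) (hα _)

lemma tsum_shift_mul_pow_eq (hα : ∀ n, ‖α n‖ ≤ 1) (h0 : 0 ≤ r) (h1 : r ≤ 1 / 2) (n : ℕ) :
    ∑' k, α (n + 2 * k) * (r : ℂ) ^ k =
      α n + r * ∑' k, α (n + 2 + 2 * k) * (r : ℂ) ^ k := by
  rw [(summable_shift_mul_pow hα h0 h1 n).tsum_eq_zero_add, ← tsum_mul_left]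
  congr 1
  · simp
  · refine tsum_congr fun k => ?_
    rw [show n + 2 * (k + 1) = n + 2 + 2 * k by ring, pow_succ]
    ring

lemma norm_tsum_shift_mul_pow_le (hα : ∀ n, ‖α n‖ ≤ 1) (h0 : 0 ≤ r) (h1 : r ≤ 1 / 2) (n : ℕ) :
    ‖∑' k, α (n + 2 * k) * (r : ℂ) ^ k‖ ≤ 2 := by
  refine (tsum_of_norm_bounded (g := fun k => r ^ k)
    (hasSum_geometric_of_lt_one h0 (by linarith)) fun k => ?_).trans ?_
  · rw [norm_mul, norm_pow, Complex.norm_real, Real.norm_of_nonneg h0]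
    exact mul_le_of_le_one_left (by positivity) (hα _)
  · rw [inv_le_comm₀ (by linarith) (by norm_num)]
    linarith

/-- Geometric averaging over even shifts with ratio `r` perturbs a unit vector of `ℓ²` by
`O(r)` in squared norm. -/
theorem abs_tsum_sq_shift_mul_pow_sub_one_le (hα : HasSum (fun n => ‖α n‖ ^ 2) 1)
    (h0 : 0 ≤ r) (h1 : r ≤ 1 / 2) :
    |(∑' n, ‖∑' k, α (n + 2 * k) * (r : ℂ) ^ k‖ ^ 2) - 1| ≤ 19 * r := by
  have hα1 (n : ℕ) : ‖α n‖ ≤ 1 := by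
    rw [← sq_le_one_iff₀ (norm_nonneg _)]
    exact le_hasSum hα n fun _ _ => by positivity
  set a : ℕ → ℂ := fun n => ∑' k, α (n + 2 * k) * (r : ℂ) ^ k with ha
  have hrec (n : ℕ) : a n = α n + r * a (n + 2) := tsum_shift_mul_pow_eq hα1 h0 h1 n
  have hle (n : ℕ) : ‖a n‖ ≤ 2 := norm_tsum_shift_mul_pow_le hα1 h0 h1 n
  have hnorm (n : ℕ) : ‖(r : ℂ) * a (n + 2)‖ = r * ‖a (n + 2)‖ := by
    rw [norm_mul, Complex.norm_real, Real.norm_of_nonneg h0]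
  have hup (n : ℕ) : ‖a n‖ ≤ ‖α n‖ + r * ‖a (n + 2)‖ := by
    rw [hrec n, ← hnorm]
    exact norm_add_le _ _
  have hlow (n : ℕ) : ‖α n‖ ≤ ‖a n‖ + r * ‖a (n + 2)‖ := by
    rw [← hnorm, show α n = a n - r * a (n + 2) by rw [hrec n]; ring]
    exact norm_sub_le _ _
  have hpartial (N : ℕ) : ∑ n ∈ Finset.range N, ‖a n‖ ^ 2 ≤ 12 := by
    have hterm (n : ℕ) : ‖a n‖ ^ 2 ≤ 2 * ‖α n‖ ^ 2 + 1 / 2 * ‖a (n + 2)‖ ^ 2 := by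
      have h : ‖a n‖ ≤ ‖α n‖ + 1 / 2 * ‖a (n + 2)‖ :=
        (hup n).trans (by gcongr)
      nlinarith [norm_nonneg (a n), sq_nonneg (‖α n‖ - 1 / 2 * ‖a (n + 2)‖)]
    have hsum := Finset.sum_le_sum fun n (_ : n ∈ Finset.range N) => hterm n
    rw [Finset.sum_add_distrib, ← Finset.mul_sum, ← Finset.mul_sum] at hsum
    have hα_le : ∑ n ∈ Finset.range N, ‖α n‖ ^ 2 ≤ 1 :=
      sum_le_hasSum _ (fun _ _ => by positivity) hα
    have hshift : ∑ n ∈ Finset.range N, ‖a (n + 2)‖ ^ 2 ≤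
        ∑ n ∈ Finset.range N, ‖a n‖ ^ 2 + 8 := by
      have e1 := Finset.sum_range_succ' (fun n => ‖a n‖ ^ 2) (N + 1)
      have e2 := Finset.sum_range_succ' (fun n => ‖a (n + 1)‖ ^ 2) N
      rw [Finset.sum_range_succ, Finset.sum_range_succ] at e1
      have b (n : ℕ) : ‖a n‖ ^ 2 ≤ 4 := by nlinarith [hle n, norm_nonneg (a n)]
      have p0 : 0 ≤ ‖a 0‖ ^ 2 := by positivity
      have p1 : 0 ≤ ‖a (0 + 1)‖ ^ 2 := by positivity
      simp only [add_assoc, Nat.reduceAdd] at e1 e2 p1 ⊢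
      linarith [b N, b (N + 1)]
    linarith
  have hsum : Summable fun n => ‖a n‖ ^ 2 :=
    summable_of_sum_range_le (fun _ => by positivity) hpartial
  have htsum : ∑' n, ‖a n‖ ^ 2 ≤ 12 :=
    Real.tsum_le_of_sum_range_le (fun _ => by positivity) hpartial
  have hsum2 : Summable fun n => ‖a (n + 2)‖ ^ 2 := (summable_nat_add_iff 2).mpr hsum
  have htsum2 : ∑' n, ‖a (n + 2)‖ ^ 2 ≤ 12 :=
    Real.tsum_le_of_sum_range_le (fun _ => by positivity) fun N => by
      have e := Finset.sum_range_add (fun n => ‖a n‖ ^ 2) 2 N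
      have p : 0 ≤ ∑ n ∈ Finset.range 2, ‖a n‖ ^ 2 := by positivity
      simp only [add_comm 2] at e
      linarith [hpartial (N + 2)]
  have hdiff (n : ℕ) : ‖‖a n‖ ^ 2 - ‖α n‖ ^ 2‖ ≤
      r * (‖a (n + 2)‖ ^ 2 + 1 / 2 * ‖a n‖ ^ 2 + 1 / 2 * ‖α n‖ ^ 2) := by
    rw [Real.norm_eq_abs, sq_sub_sq, abs_mul, abs_of_nonneg (by positivity : 0 ≤ ‖a n‖ + ‖α n‖)]
    have h : |‖a n‖ - ‖α n‖| ≤ r * ‖a (n + 2)‖ := by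
      rw [abs_le]
      constructor <;> linarith [hup n, hlow n]
    calc (‖a n‖ + ‖α n‖) * |‖a n‖ - ‖α n‖|
        ≤ (‖a n‖ + ‖α n‖) * (r * ‖a (n + 2)‖) := by gcongr
      _ = r * ((‖a n‖ + ‖α n‖) * ‖a (n + 2)‖) := by ring
      _ ≤ _ := by
        gcongr
        nlinarith [sq_nonneg (‖a n‖ - ‖a (n + 2)‖), sq_nonneg (‖α n‖ - ‖a (n + 2)‖)]
  have hmaj := ((hsum2.hasSum.add (hsum.hasSum.mul_left (1 / 2))).add
    (hα.mul_left (1 / 2))).mul_left r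
  have hfin := tsum_of_norm_bounded hmaj hdiff
  rw [hsum.tsum_sub hα.summable, hα.tsum_eq, Real.norm_eq_abs] at hfin
  refine hfin.trans ?_
  rw [mul_comm 19 r]
  gcongr
  linarith

end GeometricShift

/-- `Σ_{n≥0} |a_n(t)|² = 1 + O(M^{-1})`, uniformly in `t`: there is a universal
constant `C` such that `|Σ_n |a_n(t)|² − 1| ≤ C/M` for every `M > 2` and every real `t`. -/
theorem sum_sq_aCoeff :
    ∃ C : ℝ, 0 < C ∧ ∀ (M : ℕ), 2 < M → ∀ t : ℝ,
      |(∑' n : ℕ, ‖aCoeff M n t‖ ^ 2) - 1| ≤ C / M := by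
  refine ⟨38, by norm_num, fun M hM t => ?_⟩
  have hM' : (3 : ℝ) ≤ M := by exact_mod_cast hM
  have hcoeff (n : ℕ) : aCoeff M n t =
      ∑' k, chebAlpha (n + 2 * k) t * (((M - 1 : ℝ)⁻¹ : ℝ) : ℂ) ^ k := by
    refine tsum_congr fun k => ?_
    push_cast
    rw [inv_pow, div_eq_mul_inv]
  simp only [hcoeff]
  have hr : (M - 1 : ℝ)⁻¹ ≤ 1 / 2 := by
    rw [inv_le_comm₀ (by linarith) (by norm_num)]
    linarith
  refine (abs_tsum_sq_shift_mul_pow_sub_one_le (α := fun n => chebAlpha n t)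
    (hasSum_sq_norm_chebAlpha t) (inv_nonneg.mpr (by linarith)) hr).trans ?_
  rw [← div_eq_mul_inv, div_le_div_iff₀ (by linarith) (by linarith)]
  linarith
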